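/- Let (Ω, 𝓕, P) be a probability space equipped with a filtration (𝓕_k)_{k∈ℕ}, and let (Ψ_k)_{k∈ℕ} be a sequence of integrable real-valued random variables adapted to (𝓕_k) such that γ(Ψ_k − (1−ε)) is also integrable for every k. Let ε ∈ (0,1), let Δt ∈ (0,1], and let γ : ℝ → ℝ be concave and strictly increasing with γ(q) ≤ q for all q ∈ ℝ. Suppose that E[Ψ_0] ≥ 1 − ε and that for every k ∈ ℕ, almost surely, E[Ψ_{k+1} ∣ 𝓕_k] ≥ Ψ_k − Δt · γ(Ψ_k − (1 − ε)). Then E[Ψ_k] ≥ 1 − ε for every k ∈ ℕ. -/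

import Mathlib

open MeasureTheory

/-- Abstract probabilistic content of the paper's Theorem 1: the one-step
probabilistic-safety-certificate condition propagates the initial expected
safety level `1 - ε` to all future times. -/
theorem psc_long_term_safety
    {Ω : Type*} {m : MeasurableSpace Ω} {μ : Measure Ω} [IsProbabilityMeasure μ]
    (𝓕 : Filtration ℕ m)
    (Ψ : ℕ → Ω → ℝ)
    (hadapted : Adapted 𝓕 Ψ)
    (hint : ∀ k, Integrable (Ψ k) μ)
    (ε Δt : ℝ) (hε : ε ∈ Set.Ioo (0 : ℝ) 1) (hΔt : Δt ∈ Set.Ioc (0 : ℝ) 1)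
    (γ : ℝ → ℝ)
    (hconc : ConcaveOn ℝ Set.univ γ)
    (hmono : StrictMono γ)
    (hγle : ∀ q : ℝ, γ q ≤ q)
    (hintγ : ∀ k, Integrable (fun ω => γ (Ψ k ω - (1 - ε))) μ)
    (h0 : 1 - ε ≤ ∫ ω, Ψ 0 ω ∂μ)
    (hstep : ∀ k, ∀ᵐ ω ∂μ,
      Ψ k ω - Δt * γ (Ψ k ω - (1 - ε)) ≤ (μ[Ψ (k + 1) | 𝓕 k]) ω) :
    ∀ k, 1 - ε ≤ ∫ ω, Ψ k ω ∂μ := by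
  intro k
  induction k with
  | zero => exact h0
  | succ k ih =>
    have hlow : Integrable (fun ω => (1 - Δt) * Ψ k ω + Δt * (1 - ε)) μ :=
      ((hint k).const_mul _).add (integrable_const _)
    calc 1 - ε ≤ (1 - Δt) * ∫ ω, Ψ k ω ∂μ + Δt * (1 - ε) := by
          nlinarith [mul_nonneg (sub_nonneg.2 hΔt.2) (sub_nonneg.2 ih)]
      _ = ∫ ω, ((1 - Δt) * Ψ k ω + Δt * (1 - ε)) ∂μ := by
          rw [integral_add ((hint k).const_mul _) (integrable_const _), integral_const_mul]
          simp
      _ ≤ ∫ ω, (μ[Ψ (k + 1) | 𝓕 k]) ω ∂μ := by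
          refine integral_mono_ae hlow integrable_condExp ?_
          filter_upwards [hstep k] with ω hω
          have hγ := mul_le_mul_of_nonneg_left (hγle (Ψ k ω - (1 - ε))) hΔt.1.le
          linarith
      _ = ∫ ω, Ψ (k + 1) ω ∂μ := integral_condExp (𝓕.le k)
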